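/- arXiv:2402.18908 — 2 statements merged into one kernel-verified Lean document; each statement's English description precedes it below -/
import Mathlib

section
/- Let q : [0,1] → ℝ be a continuous scaling function with q(y) > 0 for all y, let x_1 ≤ … ≤ x_n be agent locations in [0,1] with n ≥ 1, and let mid = (x_1 + x_n)/2. Then the minimum of MC(q, ·, x) over [0,1] equals the minimum of the two quantities min_{y ∈ [0, mid]} q(y)·(x_n − y) and min_{y ∈ [mid, 1]} q(y)·(y − x_1) (all minima exist by continuity and compactness). In particular, some minimizer of the maximum cost is a minimizer of agent n's cost on [0, mid] or a minimizer of agent 1's cost on [mid, 1]. -/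
/-- The largest distance from `y` to a monotone finite family is attained at one of its ends. -/
theorem sup'_abs_sub_eq_max {n : ℕ} {x : Fin (n + 1) → ℝ} (hmono : Monotone x) (y : ℝ) :
    (Finset.univ.sup' Finset.univ_nonempty fun i => |y - x i|)
      = max (x (Fin.last n) - y) (y - x 0) := by
  apply le_antisymm
  · refine Finset.sup'_le _ _ fun i _ => ?_
    have h₀ : x 0 ≤ x i := hmono (Fin.zero_le i)
    have h₁ : x i ≤ x (Fin.last n) := hmono (Fin.le_last i)
    exact abs_le'.2 ⟨le_max_of_le_right (by linarith), le_max_of_le_left (by linarith)⟩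
  · refine max_le ?_ ?_
    · refine le_trans ?_ (Finset.le_sup' (fun i => |y - x i|) (Finset.mem_univ (Fin.last n)))
      rw [abs_sub_comm]
      exact le_abs_self _
    · exact (le_abs_self _).trans
        (Finset.le_sup' (fun i => |y - x i|) (Finset.mem_univ 0))

/-- For a continuous positive scaling function `q` and agents
`x₀ ≤ … ≤ xₙ` in `[0,1]` with `mid = (x₀ + xₙ)/2`, the minimum of the maximum cost
`y ↦ q(y) · maxᵢ |y - xᵢ|` over `[0,1]` equals the minimum of
`min_{y ∈ [0,mid]} q(y)·(xₙ - y)` and `min_{y ∈ [mid,1]} q(y)·(y - x₀)`;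
in particular, some minimizer of the maximum cost is a minimizer of the rightmost agent's
cost on `[0, mid]` or a minimizer of the leftmost agent's cost on `[mid, 1]`. -/
theorem stmt_5 (q : ℝ → ℝ) (hcont : ContinuousOn q (Set.Icc 0 1))
    (hpos : ∀ y ∈ Set.Icc (0:ℝ) 1, 0 < q y)
    (n : ℕ) (x : Fin (n+1) → ℝ) (hx : ∀ i, x i ∈ Set.Icc (0:ℝ) 1) (hmono : Monotone x)
    (mid : ℝ) (hmid : mid = (x 0 + x (Fin.last n)) / 2) :
    (sInf ((fun y => q y * Finset.univ.sup' Finset.univ_nonempty fun i => |y - x i|) ''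
        Set.Icc 0 1)
      = min (sInf ((fun y => q y * (x (Fin.last n) - y)) '' Set.Icc 0 mid))
            (sInf ((fun y => q y * (y - x 0)) '' Set.Icc mid 1))) ∧
    ∃ yStar ∈ Set.Icc (0:ℝ) 1,
      (∀ y ∈ Set.Icc (0:ℝ) 1,
        q yStar * (Finset.univ.sup' Finset.univ_nonempty fun i => |yStar - x i|)
          ≤ q y * (Finset.univ.sup' Finset.univ_nonempty fun i => |y - x i|)) ∧
      ((yStar ∈ Set.Icc 0 mid ∧
          ∀ y ∈ Set.Icc 0 mid, q yStar * (x (Fin.last n) - yStar) ≤ q y * (x (Fin.last n) - y)) ∨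
       (yStar ∈ Set.Icc mid 1 ∧
          ∀ y ∈ Set.Icc mid 1, q yStar * (yStar - x 0) ≤ q y * (y - x 0))) := by
  have h0 := hx 0
  have h1 := hx (Fin.last n)
  have hm0 : 0 ≤ mid := by linarith [h0.1, h1.1]
  have hm1 : mid ≤ 1 := by linarith [h0.2, h1.2]
  have hL : ∀ y ∈ Set.Icc 0 mid,
      q y * (Finset.univ.sup' Finset.univ_nonempty fun i => |y - x i|)
        = q y * (x (Fin.last n) - y) := fun y hy => by
    rw [sup'_abs_sub_eq_max hmono, max_eq_left (by linarith [hy.2])]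
  have hR : ∀ y ∈ Set.Icc mid 1,
      q y * (Finset.univ.sup' Finset.univ_nonempty fun i => |y - x i|)
        = q y * (y - x 0) := fun y hy => by
    rw [sup'_abs_sub_eq_max hmono, max_eq_right (by linarith [hy.1])]
  obtain ⟨a, ha, hamin⟩ := isCompact_Icc.exists_isMinOn (Set.nonempty_Icc.2 hm0)
    ((hcont.mono (Set.Icc_subset_Icc_right hm1)).mul
      (continuousOn_const.sub continuousOn_id : ContinuousOn (fun y => x (Fin.last n) - y) _))
  obtain ⟨b, hb, hbmin⟩ := isCompact_Icc.exists_isMinOn (Set.nonempty_Icc.2 hm1)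
    ((hcont.mono (Set.Icc_subset_Icc_left hm0)).mul
      (continuousOn_id.sub continuousOn_const : ContinuousOn (fun y => y - x 0) _))
  have hla : IsLeast ((fun y => q y * (x (Fin.last n) - y)) '' Set.Icc 0 mid)
      (q a * (x (Fin.last n) - a)) :=
    ⟨Set.mem_image_of_mem _ ha, Set.forall_mem_image.2 fun _ hy => hamin hy⟩
  have hlb : IsLeast ((fun y => q y * (y - x 0)) '' Set.Icc mid 1) (q b * (b - x 0)) :=
    ⟨Set.mem_image_of_mem _ hb, Set.forall_mem_image.2 fun _ hy => hbmin hy⟩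
  have hl := hla.union hlb
  rw [← Set.image_congr hL, ← Set.image_congr hR, ← Set.image_union,
    Set.Icc_union_Icc_eq_Icc hm0 hm1] at hl
  refine ⟨by rw [hl.csInf_eq, hla.csInf_eq, hlb.csInf_eq], ?_⟩
  have hmin := Set.forall_mem_image.1 hl.2
  rcases le_total (q a * (x (Fin.last n) - a)) (q b * (b - x 0)) with hab | hab
  · refine ⟨a, ⟨ha.1, ha.2.trans hm1⟩, fun y hy => ?_, Or.inl ⟨ha, fun y hy => hamin hy⟩⟩
    rw [hL a ha, ← min_eq_left hab]
    exact hmin hy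
  · refine ⟨b, ⟨hm0.trans hb.1, hb.2⟩, fun y hy => ?_, Or.inr ⟨hb, fun y hy => hbmin hy⟩⟩
    rw [hR b hb, ← min_eq_right hab]
    exact hmin hy
end

section
/- The median mechanism has total cost approximation ratio r_q: let q : [0,1] → ℝ be a continuous scaling function with q(y) > 0 for all y, let n ≥ 1, and let x_1 ≤ … ≤ x_n be agent locations in [0,1]. Let m* = x_{⌈n/2⌉} be the (left) median agent location. Then for every y ∈ [0,1], q(m*)·Σ_{i=1}^n |m* − x_i| ≤ r_q · q(y)·Σ_{i=1}^n |y − x_i|; that is, the total cost of placing the facility at the median agent is at most r_q times the optimal total cost. -/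
/-- A median of a sorted tuple minimizes the sum of absolute deviations. -/
lemma sum_abs_median_sub_le {n : ℕ} {x : Fin (n + 1) → ℝ} (hmono : Monotone x)
    {k : Fin (n + 1)} (hk : k.val = n / 2) (y : ℝ) :
    ∑ i, |x k - x i| ≤ ∑ i, |y - x i| := by
  set m := x k
  have sum_rev (z : ℝ) : ∑ i, |z - x i| + ∑ i, |z - x i|
      = ∑ i, (|z - x i| + |z - x (Fin.rev i)|) := by
    rw [Finset.sum_add_distrib]
    congr 1
    exact (Equiv.sum_comp Fin.revPerm fun i => |z - x i|).symm
  have pair_le (i : Fin (n + 1)) :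
      |m - x i| + |m - x (Fin.rev i)| ≤ |y - x i| + |y - x (Fin.rev i)| := by
    have between : (x i ≤ m ∧ m ≤ x (Fin.rev i)) ∨ (x (Fin.rev i) ≤ m ∧ m ≤ x i) := by
      rcases le_or_gt i k with h | h
      · exact .inl ⟨hmono h, hmono (by rw [Fin.le_def, Fin.val_rev]; omega)⟩
      · exact .inr ⟨hmono (by rw [Fin.le_def, Fin.val_rev]; omega), hmono h.le⟩
    rcases between with ⟨h₁, h₂⟩ | ⟨h₁, h₂⟩
    · rw [abs_of_nonneg (sub_nonneg.2 h₁), abs_of_nonpos (sub_nonpos.2 h₂)]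
      linarith [le_abs_self (y - x i), neg_abs_le (y - x (Fin.rev i))]
    · rw [abs_of_nonpos (sub_nonpos.2 h₂), abs_of_nonneg (sub_nonneg.2 h₁)]
      linarith [neg_abs_le (y - x i), le_abs_self (y - x (Fin.rev i))]
  linarith [sum_rev m, sum_rev y, Finset.sum_le_sum fun i (_ : i ∈ Finset.univ) => pair_le i]

/-- On a compact set, the ratio of the supremum to the infimum of a positive continuous function
bounds the ratio of any two of its values. -/
lemma le_sSup_div_sInf_mul {X : Type*} [TopologicalSpace X] {s : Set X} (hs : IsCompact s)
    {f : X → ℝ} (hf : ContinuousOn f s) (hpos : ∀ y ∈ s, 0 < f y)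
    {a b : X} (ha : a ∈ s) (hb : b ∈ s) :
    f a ≤ sSup (f '' s) / sInf (f '' s) * f b := by
  have hc := hs.image_of_continuousOn hf
  have h_sup : f a ≤ sSup (f '' s) := le_csSup hc.bddAbove (Set.mem_image_of_mem f ha)
  have h_inf : sInf (f '' s) ≤ f b := csInf_le hc.bddBelow (Set.mem_image_of_mem f hb)
  obtain ⟨c, hcs, hfc⟩ := hc.sInf_mem ⟨f a, Set.mem_image_of_mem f ha⟩
  have h_inf_pos : 0 < sInf (f '' s) := hfc ▸ hpos c hcs
  rw [div_mul_eq_mul_div, le_div_iff₀ h_inf_pos]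
  exact mul_le_mul h_sup h_inf h_inf_pos.le ((hpos a ha).le.trans h_sup)

/-- The median mechanism has total cost approximation ratio `r_q`: for a
continuous positive scaling function `q`, agents `x₀ ≤ … ≤ xₙ` in `[0,1]` (at least one
agent, left median agent at 0-based index `⌊n/2⌋` of the `n+1` sorted agents, i.e. the
1-based `⌈(n+1)/2⌉`-th agent), and `r_q = (max_{[0,1]} q)/(min_{[0,1]} q)`, the total cost
of placing the facility at the median agent is at most `r_q` times the total cost of any
`y ∈ [0,1]`. -/
theorem stmt_17 (q : ℝ → ℝ) (hcont : ContinuousOn q (Set.Icc 0 1))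
    (hpos : ∀ y ∈ Set.Icc (0:ℝ) 1, 0 < q y)
    (n : ℕ) (x : Fin (n+1) → ℝ) (hx : ∀ i, x i ∈ Set.Icc (0:ℝ) 1) (hmono : Monotone x)
    (rq : ℝ) (hrq : rq = sSup (q '' Set.Icc 0 1) / sInf (q '' Set.Icc 0 1)) :
    ∀ y ∈ Set.Icc (0:ℝ) 1,
      q (x ⟨n / 2, by omega⟩) * ∑ i, |x ⟨n / 2, by omega⟩ - x i|
        ≤ rq * (q y * ∑ i, |y - x i|) := by
  intro y hy
  have hq := le_sSup_div_sInf_mul isCompact_Icc hcont hpos (hx ⟨n / 2, by omega⟩) hy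
  rw [← hrq] at hq
  rw [← mul_assoc]
  exact mul_le_mul hq (sum_abs_median_sub_le hmono rfl y)
    (Finset.sum_nonneg fun _ _ => abs_nonneg _) ((hpos _ (hx _)).le.trans hq)
end
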